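/- arXiv:2305.19206 — 3 statements merged into one kernel-verified Lean document; each statement's English description precedes it below -/
import Mathlib

section
/- Suppose λ₁* > 0, η ≤ 1/(12·λ₁*), and σ₁(X_t) ≤ √(2·λ₁*). Then σ₁(J_{t+1}) ≤ (1 + η·(λ_{r+1}* − σ₁(J_t)² − σ_r(U_t)²))·σ₁(J_t). -/
open Matrix

/-- The largest singular value of a real matrix. -/
noncomputable def sigmaMax {m n : ℕ} (M : Matrix (Fin m) (Fin n) ℝ) : ℝ :=
  sSup {c : ℝ | ∃ v : EuclideanSpace ℝ (Fin n), ‖v‖ = 1 ∧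
    c = ‖(EuclideanSpace.equiv (Fin m) ℝ).symm (M.mulVec ((EuclideanSpace.equiv (Fin n) ℝ) v))‖}

/-- The smallest singular value (the `n`-th largest, for a matrix with `n` columns). -/
noncomputable def sigmaMin {m n : ℕ} (M : Matrix (Fin m) (Fin n) ℝ) : ℝ :=
  sInf {c : ℝ | ∃ v : EuclideanSpace ℝ (Fin n), ‖v‖ = 1 ∧
    c = ‖(EuclideanSpace.equiv (Fin m) ℝ).symm (M.mulVec ((EuclideanSpace.equiv (Fin n) ℝ) v))‖}

/-- Frobenius norm of a real matrix. -/
noncomputable def frobNorm {m n : ℕ} (M : Matrix (Fin m) (Fin n) ℝ) : ℝ :=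
  Real.sqrt (∑ i, ∑ j, (M i j) ^ 2)

/-- Gradient descent iterates `X_{t+1} = X_t + η (Σ - X_t X_tᵀ) X_t`. -/
noncomputable def gdIter {d r : ℕ} (S : Matrix (Fin d) (Fin d) ℝ) (η : ℝ)
    (X0 : Matrix (Fin d) (Fin r) ℝ) : ℕ → Matrix (Fin d) (Fin r) ℝ
  | 0 => X0
  | t + 1 => gdIter S η X0 t +
      η • ((S - gdIter S η X0 t * (gdIter S η X0 t)ᵀ) * gdIter S η X0 t)

/-- The top `r × r` block `U` (first `r` rows) of `X ∈ ℝ^{d×r}`. -/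
def topBlock {d r : ℕ} (h : r ≤ d) (X : Matrix (Fin d) (Fin r) ℝ) :
    Matrix (Fin r) (Fin r) ℝ :=
  fun i j => X (Fin.castLE h i) j

/-- The bottom `(d-r) × r` block `J` (last `d-r` rows) of `X ∈ ℝ^{d×r}`. -/
def botBlock {d r : ℕ} (X : Matrix (Fin d) (Fin r) ℝ) :
    Matrix (Fin (d - r)) (Fin r) ℝ :=
  fun i j => X ⟨r + (i : ℕ), by have := i.isLt; omega⟩ j

/-- The region `R = {X : σ₁(X)² ≤ 2λ₁*, σ₁(J)² ≤ λ_r* − Δ/2, σ_r(U)² ≥ Δ/4}`. -/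
def inR {d r : ℕ} (h : r ≤ d) (lam1 lamr Δ : ℝ) (X : Matrix (Fin d) (Fin r) ℝ) : Prop :=
  sigmaMax X ^ 2 ≤ 2 * lam1 ∧ sigmaMax (botBlock X) ^ 2 ≤ lamr - Δ / 2 ∧
    Δ / 4 ≤ sigmaMin (topBlock h X) ^ 2

/-- The region `R₂ = {X : σ₁(X)² ≤ 2λ₁*, σ₁(J)² ≤ λ_r* − Δ/2}`. -/
def inR2 {d r : ℕ} (lam1 lamr Δ : ℝ) (X : Matrix (Fin d) (Fin r) ℝ) : Prop :=
  sigmaMax X ^ 2 ≤ 2 * lam1 ∧ sigmaMax (botBlock X) ^ 2 ≤ lamr - Δ / 2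

theorem transpose_mul_self_eq_topBlock_add_botBlock {d r : ℕ} (h : r ≤ d)
    (X : Matrix (Fin d) (Fin r) ℝ) :
    Xᵀ * X = (topBlock h X)ᵀ * topBlock h X + (botBlock X)ᵀ * botBlock X := by
  ext i j
  simp only [Matrix.add_apply, Matrix.mul_apply, Matrix.transpose_apply, topBlock, botBlock]
  rw [← (finCongr (Nat.add_sub_cancel' h)).sum_comp, Fin.sum_univ_add]
  rfl

/-- The gradient step restricted to the last `d - r` rows. -/
theorem botBlock_add_smul_gradient {d r : ℕ} (lam : Fin d → ℝ) (η : ℝ)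
    (X : Matrix (Fin d) (Fin r) ℝ) :
    botBlock (X + η • ((Matrix.diagonal lam - X * Xᵀ) * X)) =
      botBlock X + η • (Matrix.diagonal (fun i : Fin (d - r) => lam ⟨r + i, by omega⟩) * botBlock X
        - botBlock X * (Xᵀ * X)) := by
  rw [Matrix.sub_mul, Matrix.mul_assoc]
  ext i j
  simp only [botBlock, Matrix.add_apply, Matrix.smul_apply, Matrix.sub_apply, Matrix.diagonal_mul]
  rfl

section OperatorBounds

variable {E F : Type*} [NormedAddCommGroup E] [InnerProductSpace ℝ E]
  [NormedAddCommGroup F] [InnerProductSpace ℝ F]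

open ContinuousLinearMap

/-- A positive operator whose quadratic form is at most `c ‖v‖²` has norm at most `c`. -/
theorem ContinuousLinearMap.IsPositive.opNorm_le_of_inner_le {T : E →L[ℝ] E} (hT : T.IsPositive)
    {c : ℝ} (hc : 0 ≤ c) (h : ∀ v, inner ℝ (T v) v ≤ c * ‖v‖ ^ 2) : ‖T‖ ≤ c := by
  rw [norm_eq_iSup_rayleighQuotient T hT.isSymmetric]
  refine ciSup_le fun v => ?_
  have hv : 0 ≤ inner ℝ (T v) v := hT.inner_nonneg_left v
  rw [ContinuousLinearMap.rayleighQuotient, reApplyInnerSelf_apply, RCLike.re_to_real,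
    abs_of_nonneg (div_nonneg hv (sq_nonneg _))]
  exact div_le_of_le_mul₀ (sq_nonneg _) hc (h v)

variable [CompleteSpace E] [CompleteSpace F]

/-- If `u ‖v‖ ≤ ‖U v‖` and `η ‖U‖² ≤ β`, then `‖β - η U†U‖ ≤ β - η u²`. -/
theorem ContinuousLinearMap.norm_smul_id_sub_adjoint_comp_self_le [Nontrivial E] (U : E →L[ℝ] F)
    {η β u : ℝ} (hη : 0 ≤ η) (hu : 0 ≤ u) (hU : η * ‖U‖ ^ 2 ≤ β) (hlow : ∀ v, u * ‖v‖ ≤ ‖U v‖) :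
    ‖β • ContinuousLinearMap.id ℝ E - η • (adjoint U ∘L U)‖ ≤ β - η * u ^ 2 := by
  have hinner (v : E) :
      inner ℝ ((β • ContinuousLinearMap.id ℝ E - η • (adjoint U ∘L U)) v) v =
        β * ‖v‖ ^ 2 - η * ‖U v‖ ^ 2 := by
    simp [inner_sub_left, real_inner_smul_left, adjoint_inner_left]
  have huU : u ≤ ‖U‖ := by
    obtain ⟨v, hv⟩ := exists_ne (0 : E)
    exact le_of_mul_le_mul_right ((hlow v).trans (U.le_opNorm v)) (norm_pos_iff.mpr hv)
  have hsq : u ^ 2 ≤ ‖U‖ ^ 2 := by gcongr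
  refine IsPositive.opNorm_le_of_inner_le ?_ (by nlinarith) fun v => ?_
  · rw [isPositive_def]
    refine ⟨fun v w => ?_, fun v => ?_⟩
    · simp [inner_sub_left, inner_sub_right, real_inner_smul_left, real_inner_smul_right,
        adjoint_inner_left, adjoint_inner_right]
    · have hle : ‖U v‖ ^ 2 ≤ ‖U‖ ^ 2 * ‖v‖ ^ 2 := by
        rw [← mul_pow]; gcongr; exact U.le_opNorm v
      have := (hinner v).ge
      simp only [reApplyInnerSelf_apply, RCLike.re_to_real]
      nlinarith [mul_le_mul_of_nonneg_left hle hη,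
        mul_le_mul_of_nonneg_right hU (sq_nonneg ‖v‖)]
  · rw [hinner]
    have hle : u ^ 2 * ‖v‖ ^ 2 ≤ ‖U v‖ ^ 2 := by
      rw [← mul_pow]
      exact pow_le_pow_left₀ (by positivity) (hlow v) 2
    nlinarith [mul_le_mul_of_nonneg_left hle hη]

/-- If `4 η ‖J‖² ≤ α`, then `‖J (α - η J†J)‖ ≤ ‖J‖ (α - η ‖J‖²)`. -/
theorem ContinuousLinearMap.norm_smul_sub_comp_adjoint_comp_le (J : E →L[ℝ] F)
    {η α : ℝ} (hη : 0 ≤ η) (hJ : 4 * (η * ‖J‖ ^ 2) ≤ α) :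
    ‖α • J - η • (J ∘L adjoint J ∘L J)‖ ≤ (α - η * ‖J‖ ^ 2) * ‖J‖ := by
  have he : 0 ≤ η * ‖J‖ ^ 2 := by positivity
  have hαe : 0 ≤ α - η * ‖J‖ ^ 2 := by linarith
  refine opNorm_le_bound _ (by positivity) fun v => ?_
  rcases eq_or_ne v 0 with rfl | hv
  · simp
  refine le_of_sq_le_sq ?_ (by positivity)
  have hn : 0 < ‖v‖ ^ 2 := by positivity
  set w := adjoint J (J v) with hw
  have hwv : inner ℝ w v = ‖J v‖ ^ 2 := by
    rw [hw, adjoint_inner_left, real_inner_self_eq_norm_sq]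
  have ha : ‖J v‖ ^ 2 ≤ ‖J‖ ^ 2 * ‖v‖ ^ 2 := by
    rw [← mul_pow]; gcongr; exact J.le_opNorm v
  have hb : ‖J w‖ ^ 2 ≤ ‖J‖ ^ 2 * ‖w‖ ^ 2 := by
    rw [← mul_pow]; gcongr; exact J.le_opNorm w
  have hab : (‖J v‖ ^ 2) ^ 2 ≤ ‖w‖ ^ 2 * ‖v‖ ^ 2 := by
    rw [← mul_pow]
    gcongr
    exact hwv ▸ real_inner_le_norm w v
  have hexp : ‖(α • J - η • (J ∘L adjoint J ∘L J)) v‖ ^ 2 =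
      α ^ 2 * ‖J v‖ ^ 2 - 2 * α * η * ‖w‖ ^ 2 + η ^ 2 * ‖J w‖ ^ 2 := by
    have hcross : inner ℝ (J v) (J w) = ‖w‖ ^ 2 := by
      rw [← adjoint_inner_left, ← hw, real_inner_self_eq_norm_sq]
    simp only [_root_.sub_apply, _root_.smul_apply, comp_apply, ← hw]
    rw [norm_sub_sq_real, real_inner_smul_left, real_inner_smul_right, hcross, norm_smul,
      norm_smul, mul_pow, mul_pow, Real.norm_eq_abs, Real.norm_eq_abs, sq_abs, sq_abs]
    ring
  rw [hexp, mul_pow, mul_pow]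
  generalize ‖J v‖ ^ 2 = a at *
  generalize ‖w‖ ^ 2 = b at *
  generalize ‖J w‖ ^ 2 = c at *
  generalize ‖v‖ ^ 2 = n at *
  generalize ‖J‖ ^ 2 = S at *
  have hbn : η * (2 * α - η * S) * a ^ 2 ≤ η * (2 * α - η * S) * (b * n) :=
    mul_le_mul_of_nonneg_left hab (mul_nonneg hη (by linarith))
  have hfac : 0 ≤ (S * n - a) * (α ^ 2 * n - η * (2 * α - η * S) * (S * n + a)) := by
    refine mul_nonneg (by linarith) ?_
    have h1 : η * (2 * α - η * S) * (S * n + a) ≤ η * (2 * α - η * S) * (2 * (S * n)) :=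
      mul_le_mul_of_nonneg_left (by linarith) (mul_nonneg hη (by linarith))
    have h2 : 0 ≤ (α ^ 2 - 2 * (η * S) * (2 * α - η * S)) * n :=
      mul_nonneg (by nlinarith) hn.le
    linarith
  have hc : η ^ 2 * c ≤ η ^ 2 * (S * b) := mul_le_mul_of_nonneg_left hb (sq_nonneg η)
  refine le_of_mul_le_mul_right ?_ hn
  nlinarith [mul_le_mul_of_nonneg_right hc hn.le]

end OperatorBounds

section MatrixBounds

open scoped Matrix.Norms.L2Operator

theorem bddAbove_norm_mulVec_unit {m n : ℕ} (M : Matrix (Fin m) (Fin n) ℝ) :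
    BddAbove {c : ℝ | ∃ v : EuclideanSpace ℝ (Fin n), ‖v‖ = 1 ∧
      c = ‖(EuclideanSpace.equiv (Fin m) ℝ).symm
        (M.mulVec ((EuclideanSpace.equiv (Fin n) ℝ) v))‖} := by
  refine ⟨‖M‖, ?_⟩
  rintro c ⟨v, hv, rfl⟩
  exact (Matrix.l2_opNorm_mulVec M v).trans_eq (by rw [hv, mul_one])

theorem sigmaMax_eq_l2_opNorm {m n : ℕ} (hn : 0 < n) (M : Matrix (Fin m) (Fin n) ℝ) :
    sigmaMax M = ‖M‖ := by
  have : Nonempty (Fin n) := ⟨⟨0, hn⟩⟩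
  apply le_antisymm
  · obtain ⟨v, hv⟩ := exists_norm_eq (EuclideanSpace ℝ (Fin n)) zero_le_one
    refine csSup_le ⟨_, v, hv, rfl⟩ ?_
    rintro c ⟨w, hw, rfl⟩
    exact (Matrix.l2_opNorm_mulVec M w).trans_eq (by rw [hw, mul_one])
  · rw [Matrix.l2_opNorm_def]
    refine ContinuousLinearMap.opNorm_le_of_unit_norm ?_ fun v hv => ?_
    · exact Real.sSup_nonneg (by rintro c ⟨w, -, rfl⟩; exact norm_nonneg _)
    · exact le_csSup (bddAbove_norm_mulVec_unit M) ⟨v, hv, rfl⟩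

theorem sigmaMin_nonneg {m n : ℕ} (M : Matrix (Fin m) (Fin n) ℝ) : 0 ≤ sigmaMin M :=
  Real.sInf_nonneg (by rintro c ⟨w, -, rfl⟩; exact norm_nonneg _)

theorem sigmaMin_mul_norm_le {m n : ℕ} (M : Matrix (Fin m) (Fin n) ℝ)
    (v : EuclideanSpace ℝ (Fin n)) :
    sigmaMin M * ‖v‖ ≤ ‖Matrix.toEuclideanLin M v‖ := by
  rcases eq_or_ne v 0 with rfl | hv
  · simp
  have hpos : 0 < ‖v‖ := norm_pos_iff.mpr hv
  have hle : sigmaMin M ≤ ‖Matrix.toEuclideanLin M (‖v‖⁻¹ • v)‖ :=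
    csInf_le ⟨0, by rintro c ⟨w, -, rfl⟩; exact norm_nonneg _⟩
      ⟨‖v‖⁻¹ • v, by simp [norm_smul, hpos.ne'], rfl⟩
  rwa [map_smul, norm_smul, norm_inv, norm_norm, inv_mul_eq_div, le_div_iff₀ hpos] at hle

theorem Matrix.toEuclideanLin_transpose_toContinuousLinearMap {m n : ℕ}
    (M : Matrix (Fin m) (Fin n) ℝ) :
    LinearMap.toContinuousLinearMap (Matrix.toEuclideanLin Mᵀ) =
      ContinuousLinearMap.adjoint (LinearMap.toContinuousLinearMap (Matrix.toEuclideanLin M)) := by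
  rw [← Matrix.conjTranspose_eq_transpose_of_trivial,
    Matrix.toEuclideanLin_conjTranspose_eq_adjoint, LinearMap.adjoint_toContinuousLinearMap]

/-- If `4 η ‖J‖² ≤ α`, then `‖J (α - η JᵀJ)‖ ≤ ‖J‖ (α - η ‖J‖²)`. -/
theorem Matrix.l2_opNorm_smul_sub_mul_transpose_mul_le {m n : ℕ} (J : Matrix (Fin m) (Fin n) ℝ)
    {η α : ℝ} (hη : 0 ≤ η) (hJ : 4 * (η * ‖J‖ ^ 2) ≤ α) :
    ‖α • J - η • (J * (Jᵀ * J))‖ ≤ (α - η * ‖J‖ ^ 2) * ‖J‖ := by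
  have key := ContinuousLinearMap.norm_smul_sub_comp_adjoint_comp_le
    (LinearMap.toContinuousLinearMap (Matrix.toEuclideanLin J)) hη hJ
  rw [← Matrix.toEuclideanLin_transpose_toContinuousLinearMap] at key
  refine le_of_eq_of_le ?_ key
  rw [Matrix.l2_opNorm_def]
  congr 1
  ext v : 1
  simp [Matrix.toLpLin_mul (q := 2)]

/-- If `η ‖U‖² ≤ β`, then `‖β - η UᵀU‖ ≤ β - η σ_min(U)²`. -/
theorem Matrix.l2_opNorm_smul_one_sub_transpose_mul_self_le {m n : ℕ} (hn : 0 < n)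
    (U : Matrix (Fin m) (Fin n) ℝ) {η β : ℝ} (hη : 0 ≤ η) (hU : η * ‖U‖ ^ 2 ≤ β) :
    ‖β • (1 : Matrix (Fin n) (Fin n) ℝ) - η • (Uᵀ * U)‖ ≤ β - η * sigmaMin U ^ 2 := by
  have : Nonempty (Fin n) := ⟨⟨0, hn⟩⟩
  have key := ContinuousLinearMap.norm_smul_id_sub_adjoint_comp_self_le
    (LinearMap.toContinuousLinearMap (Matrix.toEuclideanLin U)) hη (sigmaMin_nonneg U) hU
    (sigmaMin_mul_norm_le U)
  rw [← Matrix.toEuclideanLin_transpose_toContinuousLinearMap] at key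
  refine le_of_eq_of_le ?_ key
  rw [Matrix.l2_opNorm_def]
  congr 1
  ext v : 1
  simp [Matrix.toLpLin_mul (q := 2)]

theorem Matrix.l2_opNorm_submatrix_le {m n k : ℕ} (M : Matrix (Fin m) (Fin n) ℝ)
    {f : Fin k → Fin m} (hf : Function.Injective f) : ‖M.submatrix f id‖ ≤ ‖M‖ := by
  rw [Matrix.l2_opNorm_def]
  refine ContinuousLinearMap.opNorm_le_bound _ (norm_nonneg _) fun v => ?_
  refine le_trans ?_ (Matrix.l2_opNorm_mulVec M v)
  simp only [EuclideanSpace.norm_eq]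
  refine Real.sqrt_le_sqrt ?_
  have himage := Finset.sum_image (s := Finset.univ) (g := f)
    (f := fun i => ‖((EuclideanSpace.equiv (Fin m) ℝ).symm (M *ᵥ v)) i‖ ^ 2) hf.injOn
  exact himage.symm.trans_le <|
    Finset.sum_le_sum_of_subset_of_nonneg (Finset.subset_univ _) fun _ _ _ => sq_nonneg _

/-- Operator norm bound for one gradient step on the block `J`, with `D` in place of `Σ`. -/
theorem Matrix.l2_opNorm_gradient_step_le {m n k : ℕ} (hn : 0 < n) (J : Matrix (Fin m) (Fin n) ℝ)
    (U : Matrix (Fin k) (Fin n) ℝ) (D : Matrix (Fin m) (Fin m) ℝ) {η l : ℝ} (hη : 0 ≤ η)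
    (hD : ‖D‖ ≤ l) (hJ : η * ‖J‖ ^ 2 ≤ 1 / 6) (hU : η * ‖U‖ ^ 2 ≤ 1 / 6) :
    ‖J + η • (D * J - J * (Uᵀ * U + Jᵀ * J))‖ ≤
      (1 + η * (l - ‖J‖ ^ 2 - sigmaMin U ^ 2)) * ‖J‖ := by
  have hdecomp : J + η • (D * J - J * (Uᵀ * U + Jᵀ * J)) =
      (((2 / 3 : ℝ) • J - η • (J * (Jᵀ * J))) +
        J * ((1 / 3 : ℝ) • (1 : Matrix (Fin n) (Fin n) ℝ) - η • (Uᵀ * U))) + η • (D * J) := by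
    simp only [Matrix.mul_sub, Matrix.mul_add, Matrix.mul_smul, Matrix.mul_one]
    module
  have hquad := J.l2_opNorm_smul_sub_mul_transpose_mul_le (α := 2 / 3) hη (by linarith)
  have hlin := (J.l2_opNorm_mul _).trans <| mul_le_mul_of_nonneg_left
    (U.l2_opNorm_smul_one_sub_transpose_mul_self_le (β := 1 / 3) hn hη (by linarith))
    (norm_nonneg J)
  have hdiag : ‖η • (D * J)‖ ≤ η * (l * ‖J‖) := by
    rw [norm_smul, Real.norm_of_nonneg hη]
    gcongr
    exact (D.l2_opNorm_mul J).trans (by gcongr)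
  rw [hdecomp]
  refine (norm_add₃_le.trans (add_le_add (add_le_add hquad hlin) hdiag)).trans_eq ?_
  ring

theorem sigmaMax_botBlock_gradient_step_le {d r : ℕ} (hr : 0 < r) (hrd : r < d)
    {lam : Fin d → ℝ} (hmono : Antitone lam) (hnn : ∀ i, 0 ≤ lam i)
    {η l₁ : ℝ} (hη : 0 ≤ η) (hl₁ : 0 < l₁) (hηle : η ≤ 1 / (12 * l₁))
    (X : Matrix (Fin d) (Fin r) ℝ) (hX : sigmaMax X ≤ Real.sqrt (2 * l₁)) :
    sigmaMax (botBlock (X + η • ((Matrix.diagonal lam - X * Xᵀ) * X))) ≤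
      (1 + η * (lam ⟨r, hrd⟩ - sigmaMax (botBlock X) ^ 2 - sigmaMin (topBlock hrd.le X) ^ 2)) *
        sigmaMax (botBlock X) := by
  rw [botBlock_add_smul_gradient, transpose_mul_self_eq_topBlock_add_botBlock hrd.le]
  rw [sigmaMax_eq_l2_opNorm hr] at hX ⊢
  rw [sigmaMax_eq_l2_opNorm hr]
  have hbound {s : ℝ} (hs : 0 ≤ s) (hsX : s ≤ ‖X‖) : η * s ^ 2 ≤ 1 / 6 := by
    have hsq : s ^ 2 ≤ 2 * l₁ := by
      rw [← Real.sq_sqrt (by positivity : 0 ≤ 2 * l₁)]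
      exact pow_le_pow_left₀ hs (hsX.trans hX) 2
    rw [le_div_iff₀ (by positivity)] at hηle
    nlinarith
  have hJ := hbound (norm_nonneg (botBlock X)) <|
    X.l2_opNorm_submatrix_le (f := fun i : Fin (d - r) => ⟨r + i, by omega⟩)
      fun i j hij => by simpa [Fin.ext_iff] using hij
  have hU := hbound (norm_nonneg (topBlock hrd.le X)) <|
    X.l2_opNorm_submatrix_le (Fin.castLE_injective hrd.le)
  have hD : ‖Matrix.diagonal fun i : Fin (d - r) => lam ⟨r + i, by omega⟩‖ ≤ lam ⟨r, hrd⟩ := by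
    rw [Matrix.l2_opNorm_diagonal]
    refine (pi_norm_le_iff_of_nonneg (hnn _)).2 fun i => ?_
    rw [Real.norm_of_nonneg (hnn _)]
    exact hmono (Fin.mk_le_mk.2 (Nat.le_add_right _ _))
  exact Matrix.l2_opNorm_gradient_step_le hr _ _ _ hη hD hJ hU

end MatrixBounds

/-- Lemma A.5: one-step upper bound on `σ₁(J_t)`. -/
theorem J_one_step (d r : ℕ) (hr : 0 < r) (hrd : r < d)
    (lam : Fin d → ℝ)
    (hmono : ∀ i j : Fin d, i ≤ j → lam j ≤ lam i)
    (hnn : ∀ i, 0 ≤ lam i)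
    (hlam1 : 0 < lam ⟨0, by omega⟩)
    (η : ℝ) (hη : 0 < η)
    (hηle : η ≤ 1 / (12 * lam ⟨0, by omega⟩))
    (X0 : Matrix (Fin d) (Fin r) ℝ) (t : ℕ)
    (hXt : sigmaMax (gdIter (Matrix.diagonal lam) η X0 t) ≤ Real.sqrt (2 * lam ⟨0, by omega⟩)) :
    sigmaMax (botBlock (gdIter (Matrix.diagonal lam) η X0 (t + 1))) ≤
      (1 + η * (lam ⟨r, hrd⟩ -
          sigmaMax (botBlock (gdIter (Matrix.diagonal lam) η X0 t)) ^ 2 -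
          sigmaMin (topBlock hrd.le (gdIter (Matrix.diagonal lam) η X0 t)) ^ 2)) *
        sigmaMax (botBlock (gdIter (Matrix.diagonal lam) η X0 t)) := by
  exact sigmaMax_botBlock_gradient_step_le hr hrd (fun i j hij => hmono i j hij) hnn hη.le hlam1
    hηle _ hXt
end

section
/- Let Σ ∈ ℝ^{d×d} be symmetric and η ∈ ℝ. Let X, Y ∈ ℝ^{d×r} and define the one-step updates X' = X + η(Σ − XYᵀ)Y − (η/2)·X(XᵀX − YᵀY) and Y' = Y + η(Σ − XYᵀ)ᵀX + (η/2)·Y(XᵀX − YᵀY). Define W ∈ ℝ^{2d×r} as the block matrix with top block (X + Y)/√2 and bottom block (X − Y)/√2, W' ∈ ℝ^{2d×r} analogously from X', Y', and Σ̃ ∈ ℝ^{2d×2d} as the block-diagonal matrix diag(2Σ, −2Σ). Then W' = W + (η/2)·(Σ̃ W − W WᵀW). -/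
open Matrix

/-- The Gram matrix of the rotated pair `((X + Y) / √2, (X - Y) / √2)`. -/
theorem gram_rotated_fromRows {m n : Type*} [Fintype m] (X Y : Matrix m n ℝ) :
    ((Real.sqrt 2)⁻¹ • Matrix.fromRows (X + Y) (X - Y))ᵀ *
        ((Real.sqrt 2)⁻¹ • Matrix.fromRows (X + Y) (X - Y)) = Xᵀ * X + Yᵀ * Y := by
  have h : (Real.sqrt 2)⁻¹ * (Real.sqrt 2)⁻¹ = 1 / 2 := by
    rw [← mul_inv, Real.mul_self_sqrt (by norm_num), one_div]
  rw [transpose_smul, transpose_fromRows, Matrix.smul_mul, Matrix.mul_smul, smul_smul, h,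
    fromCols_mul_fromRows]
  simp only [transpose_add, transpose_sub, Matrix.add_mul, Matrix.mul_add, Matrix.sub_mul,
    Matrix.mul_sub]
  module

/-- Reduction of one step of gradient descent on the regularized asymmetric objective to
one step of symmetric gradient descent with target `Σ̃ = diag(2Σ, −2Σ)` and rate `η/2`. -/
theorem asymmetric_to_symmetric_reduction (d r : ℕ)
    (S : Matrix (Fin d) (Fin d) ℝ) (hS : Sᵀ = S) (η : ℝ)
    (X Y : Matrix (Fin d) (Fin r) ℝ) :
    (Real.sqrt 2)⁻¹ • Matrix.fromRows
        ((X + η • ((S - X * Yᵀ) * Y) - (η / 2) • (X * (Xᵀ * X - Yᵀ * Y))) +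
          (Y + η • ((S - X * Yᵀ)ᵀ * X) + (η / 2) • (Y * (Xᵀ * X - Yᵀ * Y))))
        ((X + η • ((S - X * Yᵀ) * Y) - (η / 2) • (X * (Xᵀ * X - Yᵀ * Y))) -
          (Y + η • ((S - X * Yᵀ)ᵀ * X) + (η / 2) • (Y * (Xᵀ * X - Yᵀ * Y)))) =
      (Real.sqrt 2)⁻¹ • Matrix.fromRows (X + Y) (X - Y) +
        (η / 2) •
          (Matrix.fromBlocks ((2 : ℝ) • S) 0 0 ((-2 : ℝ) • S) *
              ((Real.sqrt 2)⁻¹ • Matrix.fromRows (X + Y) (X - Y)) -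
            ((Real.sqrt 2)⁻¹ • Matrix.fromRows (X + Y) (X - Y)) *
              (((Real.sqrt 2)⁻¹ • Matrix.fromRows (X + Y) (X - Y))ᵀ *
                ((Real.sqrt 2)⁻¹ • Matrix.fromRows (X + Y) (X - Y)))) := by
  rw [gram_rotated_fromRows, Matrix.mul_smul, Matrix.smul_mul, ← smul_sub,
    smul_comm (η / 2), ← smul_add, fromBlocks_mul_fromRows, fromRows_mul]
  congr 1
  ext i j
  rcases i with i | i <;>
  · simp only [Matrix.add_apply, Matrix.smul_apply, Matrix.sub_apply, fromRows_apply_inl,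
      fromRows_apply_inr, transpose_sub, transpose_mul, transpose_transpose, hS, Matrix.add_mul,
      Matrix.mul_add, Matrix.sub_mul, Matrix.mul_sub, Matrix.smul_mul, Matrix.zero_mul,
      Matrix.zero_apply, Matrix.mul_assoc, smul_eq_mul]
    ring
end

section
/- Let Σ ∈ ℝ^{d×d} be positive semidefinite with positive semidefinite square root Σ^{1/2}, and let η ∈ ℝ. Let L, L' ∈ ℝ^{d×r} satisfy the retraction-free Riemannian gradient descent step L' = L + η(I_d − LLᵀ)ΣL. Define X = Σ^{1/2}L and X' = Σ^{1/2}L'. Then X' = X + ηΣX − η·X XᵀX. -/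
open Matrix

/-- The transformed sequence `X = Σ^{1/2} L` of the retraction-free method follows the
symmetric matrix-approximation gradient descent update. -/
theorem retraction_free_transform (d r : ℕ)
    (S Shalf : Matrix (Fin d) (Fin d) ℝ)
    (hS : S.PosSemidef) (hShalf : Shalf.PosSemidef) (hSS : Shalf * Shalf = S)
    (η : ℝ) (L L' : Matrix (Fin d) (Fin r) ℝ)
    (hstep : L' = L + η • ((1 - L * Lᵀ) * (S * L))) :
    Shalf * L' =
      Shalf * L + η • (S * (Shalf * L)) -
        η • (Shalf * L * ((Shalf * L)ᵀ * (Shalf * L))) := by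
  have hT : Shalfᵀ = Shalf := by
    simpa [conjTranspose_eq_transpose_of_trivial] using hShalf.isHermitian.eq
  subst hstep hSS
  simp only [transpose_mul, hT, Matrix.mul_add, Matrix.mul_smul, Matrix.sub_mul,
    Matrix.mul_sub, Matrix.one_mul, smul_sub, Matrix.mul_assoc, add_sub_assoc]
end
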